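/- Every strongly interference-free injective morphism φ : Σ* → Γ* is recognizable, i.e., recognizable on the set of all words over Σ. -/

import Mathlib

/-- Extension of a letter map `φ` to a morphism on words. -/
def wlift {α β : Type*} (φ : α → List β) (u : List α) : List β := (u.map φ).flatten

/-- Set of starting positions (0-indexed) of occurrences of `u` in `w`. -/
def Occ {β : Type*} (u w : List β) : Set ℕ := {i | i ≤ w.length ∧ u <+: w.drop i}

/-- Number of occurrences of `u` as a factor of `w`. -/
noncomputable def occ {β : Type*} (u w : List β) : ℕ := (Occ u w).ncard

/-- `w` admits a `φ`-image factorization. -/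
def ImageFact {α β : Type*} (φ : α → List β) (w : List β) : Prop :=
  ∃ s : List α, w = wlift φ s

/-- `w` admits an interfered `φ`-image factorization. -/
def InterferedFact {α β : Type*} (φ : α → List β) (w : List β) : Prop :=
  ∃ x y z : List β, w = x ++ y ++ z ∧
    (∃ c : α, x <:+ φ c ∧ x ≠ φ c) ∧
    ImageFact φ y ∧
    (∃ c' : α, z <+: φ c' ∧ z ≠ φ c') ∧
    x ++ z ≠ []

/-- `w` is an inner `φ`-image factor. -/
def InnerImageFactor {α β : Type*} (φ : α → List β) (w : List β) : Prop :=
  ∃ c : α, w <:+: φ c ∧ ¬ w <+: φ c ∧ ¬ w <:+ φ c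

/-- `φ` is interference-free on the set `L` of words. -/
def InterferenceFree {α β : Type*} (φ : α → List β) (L : Set (List α)) : Prop :=
  ∀ u ∈ L, u ≠ [] →
    ¬ InterferedFact φ (wlift φ u) ∧ ¬ InnerImageFactor φ (wlift φ u)

/-- `t = (q, r, p)` is a circular `φ`-image factorization of `w`. -/
def CircFact {α β : Type*} (φ : α → List β) (w : List β)
    (t : List β × List β × List β) : Prop :=
  w = t.1 ++ t.2.1 ++ t.2.2 ∧ ImageFact φ t.2.1 ∧
    (∃ c : α, t.2.2 ++ t.1 = φ c) ∧ t.2.2 ≠ []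

/-- `φ` is recognizable on the set `L` of words. -/
def Recognizable {α β : Type*} (φ : α → List β) (L : Set (List α)) : Prop :=
  ∀ u ∈ L, u ≠ [] → ∀ i : ℕ, i < (wlift φ u).length →
    ∃! t : List β × List β × List β,
      CircFact φ ((wlift φ u).drop i ++ (wlift φ u).take i) t

theorem wlift_append {α β : Type*} (φ : α → List β) (u v : List α) :
    wlift φ (u ++ v) = wlift φ u ++ wlift φ v := by
  simp [wlift]

theorem wlift_cons {α β : Type*} (φ : α → List β) (c : α) (u : List α) :
    wlift φ (c :: u) = φ c ++ wlift φ u := by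
  simp [wlift]

theorem wlift_singleton {α β : Type*} (φ : α → List β) (c : α) : wlift φ [c] = φ c := by
  simp [wlift]

/-- A cut of a morphic image after a nonempty prefix falls inside, or at the end of, the image
of some letter. -/
theorem exists_letter_of_wlift_eq_append {α β : Type*} (φ : α → List β) (u : List α) :
    ∀ a b : List β, wlift φ u = a ++ b → a ≠ [] →
      ∃ (u₁ u₂ : List α) (c : α) (p q : List β),
        a = wlift φ u₁ ++ p ∧ b = q ++ wlift φ u₂ ∧ p ++ q = φ c ∧ p ≠ [] := by
  induction u with
  | nil =>
    intro a b h ha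
    simp_all [wlift]
  | cons c u ih =>
    intro a b h ha
    rw [wlift_cons, List.append_eq_append_iff] at h
    rcases h with ⟨d, rfl, hu⟩ | ⟨d, hc, rfl⟩
    · by_cases hd : d = []
      · subst hd
        exact ⟨[], u, c, φ c, [], by simp [wlift], by simpa using hu.symm, by simp,
          by simpa using ha⟩
      · obtain ⟨u₁, u₂, c', p, q, rfl, hb, hpq, hp⟩ := ih d b hu hd
        exact ⟨c :: u₁, u₂, c', p, q, by simp [wlift_cons], hb, hpq, hp⟩
    · exact ⟨[], u, c, a, d, by simp [wlift], rfl, hc.symm, ha⟩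

/-- Moving a prefix of a nonempty morphic image to its end yields a word with a circular
factorization. -/
theorem exists_circFact_append_swap {α β : Type*} (φ : α → List β) (u : List α)
    (a b : List β) (h : wlift φ u = a ++ b) (ha : a ≠ []) :
    ∃ t, CircFact φ (b ++ a) t := by
  obtain ⟨u₁, u₂, c, p, q, rfl, rfl, hpq, hp⟩ := exists_letter_of_wlift_eq_append φ u a b h ha
  exact ⟨(q, wlift φ (u₂ ++ u₁), p), by simp [wlift_append], ⟨_, rfl⟩, ⟨c, hpq⟩, hp⟩

/-- Without interference, a circular factorization of a morphic image starts at a cut. -/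
theorem CircFact.fst_eq_nil {α β : Type*} {φ : α → List β} {v : List α}
    (hv : ¬ InterferedFact φ (wlift φ v)) {t : List β × List β × List β}
    (ht : CircFact φ (wlift φ v) t) : t.1 = [] := by
  obtain ⟨hw, hr, ⟨c, hc⟩, hp⟩ := ht
  by_contra hq
  refine hv ⟨t.1, t.2.1, t.2.2, hw, ⟨c, ⟨_, hc⟩, fun h => hp ?_⟩, hr,
    ⟨c, ⟨_, hc⟩, fun h => hq ?_⟩, by simp [hq]⟩
  · simpa [← hc] using h
  · simpa [← hc] using h

/-- Of two circular factorizations of the same word, the one with the shorter first component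
determines the other. -/
theorem CircFact.eq_of_prefix {α β : Type*} {φ : α → List β}
    (hinj : Function.Injective (wlift φ)) (hsif : InterferenceFree φ Set.univ)
    {w : List β} {t t' : List β × List β × List β} (ht : CircFact φ w t)
    (ht' : CircFact φ w t') (h : t.1 <+: t'.1) : t = t' := by
  obtain ⟨q, r, p⟩ := t
  obtain ⟨q', r', p'⟩ := t'
  obtain ⟨d, rfl⟩ : ∃ d, q ++ d = q' := h
  obtain ⟨rfl, ⟨s, hs⟩, ⟨c, hc⟩, hp⟩ := ht
  obtain ⟨hw', ⟨s', hs'⟩, ⟨c', hc'⟩, hp'⟩ := ht'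
  dsimp only at *
  have hrp : r ++ p = d ++ r' ++ p' := by simpa using hw'
  have hsc : wlift φ (s ++ [c]) = r ++ p ++ q := by
    rw [wlift_append, wlift_singleton, ← hs, ← hc, List.append_assoc]
  have hd : d = [] := by
    have hcirc : CircFact φ (wlift φ (s ++ [c])) (d, r', p' ++ q) :=
      ⟨by rw [hsc, hrp]; simp, ⟨s', hs'⟩, ⟨c', by simpa using hc'⟩, by simp [hp']⟩
    exact hcirc.fst_eq_nil (hsif (s ++ [c]) trivial (by simp)).1
  subst hd
  have hsc' : wlift φ (s' ++ [c']) = r' ++ p' ++ q := by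
    rw [wlift_append, wlift_singleton, ← hs', ← hc']
    simp
  have hv : s ++ [c] = s' ++ [c'] := hinj (by rw [hsc, hsc', hrp]; simp)
  have hr : r = r' := by rw [hs, hs', (List.append_inj' hv rfl).1]
  subst hr
  simpa using hrp

theorem sif_implies_recognizable {α β : Type*} (φ : α → List β)
    (hinj : Function.Injective (wlift φ))
    (hsif : InterferenceFree φ Set.univ) :
    Recognizable φ Set.univ := by
  intro u _ _ i hi
  obtain ⟨t, ht⟩ : ∃ t, CircFact φ ((wlift φ u).drop i ++ (wlift φ u).take i) t := by
    rcases Nat.eq_zero_or_pos i with rfl | hpos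
    · simpa using exists_circFact_append_swap φ u (wlift φ u) [] (by simp)
        (List.ne_nil_of_length_pos hi)
    · exact exists_circFact_append_swap φ u _ _ (List.take_append_drop i _).symm
        (List.ne_nil_of_length_pos (by simp; omega))
  refine ⟨t, ht, fun t' ht' => ?_⟩
  have hpre : t.1 <+: (wlift φ u).drop i ++ (wlift φ u).take i :=
    ⟨t.2.1 ++ t.2.2, by rw [ht.1, List.append_assoc]⟩
  have hpre' : t'.1 <+: (wlift φ u).drop i ++ (wlift φ u).take i :=
    ⟨t'.2.1 ++ t'.2.2, by rw [ht'.1, List.append_assoc]⟩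
  rcases List.prefix_or_prefix_of_prefix hpre hpre' with h | h
  · exact (ht.eq_of_prefix hinj hsif ht' h).symm
  · exact ht'.eq_of_prefix hinj hsif ht h
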